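/- (Lovejoy's Bailey pair identity) For |q| < 1, Σ_{n≥1} ((q;q)_{n−1} (−1)^n q^{n(n+1)/2})/(−q;q)_n = Σ_{n≥1} Σ_{−n < j ≤ n} (−1)^{n+j+1} q^{2n^2−j^2}. -/

import Mathlib

open Finset

open Filter Topology

/-- The reciprocal `1 / (q; q)_k`, extended by zero to negative `k`. -/
noncomputable def qPochhammerInv (q : ℂ) (k : ℤ) : ℂ :=
  if k < 0 then 0 else (∏ i ∈ range k.toNat, (1 - q ^ (i + 1)))⁻¹

/-- The sum `∑_{-r < j ≤ r} (-1)^j q^(r^2 - j^2)`, defined by its recurrence. -/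
def thetaSum (q : ℂ) : ℕ → ℂ
  | 0 => 0
  | r + 1 => q ^ (2 * r + 1) * thetaSum q r + (-1) ^ r * (q ^ (2 * r + 1) - 1)

/-- The sequence `(q; q)_n (-1)^(n+1) q^((n+1)(n+2)/2)`. -/
noncomputable def signedWeight (q : ℂ) (n : ℕ) : ℂ :=
  (∏ k ∈ range n, (1 - q ^ (k + 1))) * (-1 : ℂ) ^ (n + 1) * q ^ ((n + 1) * (n + 2) / 2)

lemma triangle_succ (r : ℕ) : (r + 1) * (r + 2) / 2 = r * (r + 1) / 2 + (r + 1) := by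
  have : (r + 1) * (r + 2) = r * (r + 1) + 2 * (r + 1) := by ring
  omega

lemma one_sub_pow_ne_zero {q : ℂ} (hq : ‖q‖ < 1) (n : ℕ) : 1 - q ^ (n + 1) ≠ 0 := by
  intro h
  have h1 : ‖q ^ (n + 1)‖ < 1 := by
    rw [norm_pow]; exact pow_lt_one₀ (norm_nonneg _) hq (Nat.succ_ne_zero n)
  rw [← sub_eq_zero.mp h] at h1
  simp at h1

lemma one_add_pow_ne_zero {q : ℂ} (hq : ‖q‖ < 1) (n : ℕ) : 1 + q ^ (n + 1) ≠ 0 := by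
  intro h
  have h1 : ‖q ^ (n + 1)‖ < 1 := by
    rw [norm_pow]; exact pow_lt_one₀ (norm_nonneg _) hq (Nat.succ_ne_zero n)
  rw [eq_neg_of_add_eq_zero_right h] at h1
  simp at h1

lemma qPochhammerInv_of_neg (q : ℂ) {k : ℤ} (hk : k < 0) : qPochhammerInv q k = 0 := by
  simp [qPochhammerInv, hk]

lemma qPochhammerInv_natCast (q : ℂ) (k : ℕ) :
    qPochhammerInv q k = (∏ i ∈ range k, (1 - q ^ (i + 1)))⁻¹ := by
  simp [qPochhammerInv]

lemma qPochhammerInv_sub_one {q : ℂ} (hq : ‖q‖ < 1) (k : ℤ) :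
    qPochhammerInv q (k - 1) = (1 - q ^ k) * qPochhammerInv q k := by
  rcases lt_or_ge k 0 with hk | hk
  · rw [qPochhammerInv_of_neg q hk, qPochhammerInv_of_neg q (by omega), mul_zero]
  · obtain ⟨m, rfl⟩ := Int.eq_ofNat_of_zero_le hk
    rcases m with _ | m
    · simp [qPochhammerInv]
    · have h := one_sub_pow_ne_zero hq m
      rw [show ((m + 1 : ℕ) : ℤ) - 1 = (m : ℕ) by push_cast; ring, qPochhammerInv_natCast,
        qPochhammerInv_natCast, prod_range_succ, zpow_natCast, mul_inv]
      field_simp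

lemma norm_qPochhammerInv_le {q : ℂ} (hq : ‖q‖ < 1) (k : ℕ) :
    ‖qPochhammerInv q k‖ ≤ ((1 - ‖q‖)⁻¹) ^ k := by
  rw [qPochhammerInv_natCast, norm_inv, norm_prod, inv_pow]
  have h0 : 0 < 1 - ‖q‖ := by linarith
  refine inv_anti₀ (pow_pos h0 _) ?_
  rw [← card_range k, ← prod_const, card_range]
  refine prod_le_prod (fun _ _ => h0.le) fun i _ => ?_
  calc 1 - ‖q‖ ≤ 1 - ‖q ^ (i + 1)‖ := by
        rw [norm_pow]
        exact sub_le_sub_left (pow_le_of_le_one (norm_nonneg q) hq.le (Nat.succ_ne_zero i)) 1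
    _ ≤ ‖1 - q ^ (i + 1)‖ := by simpa using norm_sub_norm_le (1 : ℂ) (q ^ (i + 1))

lemma norm_one_sub_pow_le {q : ℂ} (hq : ‖q‖ < 1) (n : ℕ) : ‖1 - q ^ n‖ ≤ 2 := by
  have h : ‖q ^ n‖ ≤ 1 := by rw [norm_pow]; exact pow_le_one₀ (norm_nonneg _) hq.le
  calc ‖1 - q ^ n‖ ≤ ‖(1 : ℂ)‖ + ‖q ^ n‖ := norm_sub_le _ _
    _ ≤ 2 := by rw [norm_one]; linarith

lemma norm_thetaSum_le {q : ℂ} (hq : ‖q‖ < 1) (r : ℕ) : ‖thetaSum q r‖ ≤ 2 * r := by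
  induction r with
  | zero => simp [thetaSum]
  | succ r ih =>
    have h : ‖q ^ (2 * r + 1)‖ ≤ 1 := by rw [norm_pow]; exact pow_le_one₀ (norm_nonneg _) hq.le
    have h2 := norm_one_sub_pow_le hq (2 * r + 1)
    rw [thetaSum]
    calc _ ≤ ‖q ^ (2 * r + 1) * thetaSum q r‖ + ‖(-1) ^ r * (q ^ (2 * r + 1) - 1)‖ :=
          norm_add_le _ _
      _ = ‖q ^ (2 * r + 1)‖ * ‖thetaSum q r‖ + ‖1 - q ^ (2 * r + 1)‖ := by
          rw [norm_mul, norm_mul, norm_sub_rev]; simp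
      _ ≤ 1 * (2 * r) + 2 := by gcongr
      _ = _ := by push_cast; ring

lemma signedWeight_succ (q : ℂ) (n : ℕ) :
    signedWeight q (n + 1) = -((1 - q ^ (n + 1)) * q ^ (n + 2)) * signedWeight q n := by
  simp only [signedWeight]
  rw [prod_range_succ, triangle_succ (n + 1)]
  ring

lemma norm_signedWeight_le {q : ℂ} (hq : ‖q‖ < 1) (n : ℕ) :
    ‖signedWeight q n‖ ≤ 2 ^ n * ‖q‖ ^ ((n + 1) * (n + 2) / 2) := by
  rw [signedWeight, norm_mul, norm_mul, norm_prod, norm_pow, norm_pow]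
  simp only [norm_neg, norm_one, one_pow, mul_one]
  gcongr
  calc _ ≤ ∏ k ∈ range n, (2 : ℝ) :=
        prod_le_prod (fun _ _ => norm_nonneg _) fun i _ => norm_one_sub_pow_le hq (i + 1)
    _ = _ := by simp

lemma norm_kernel_le {q : ℂ} (hq : ‖q‖ < 1) (n r : ℕ) :
    ‖qPochhammerInv q ((n : ℤ) + 1 - r) * qPochhammerInv q ((n : ℤ) + 1 + r)‖ ≤
      ((1 - ‖q‖)⁻¹) ^ (2 * n + 2) := by
  have h0 : 0 < (1 - ‖q‖)⁻¹ := inv_pos.mpr (by linarith)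
  rcases lt_or_ge (n + 1) r with h | h
  · rw [qPochhammerInv_of_neg q (by omega)]
    simpa using (pow_pos h0 _).le
  · obtain ⟨m, hm⟩ := Nat.exists_eq_add_of_le h
    rw [show (n : ℤ) + 1 - r = (m : ℕ) by omega,
      show (n : ℤ) + 1 + r = ((n + 1 + r : ℕ) : ℤ) by push_cast; ring, norm_mul,
      show 2 * n + 2 = m + (n + 1 + r) by omega, pow_add]
    gcongr <;> exact norm_qPochhammerInv_le hq _

lemma summable_pow_mul_pow_triangle {x : ℝ} (hx : 0 < x) (hx1 : x < 1) {A : ℝ} (hA : 0 < A) :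
    Summable fun n : ℕ => A ^ n * x ^ ((n + 1) * (n + 2) / 2) := by
  have hlim : Tendsto (fun n : ℕ => A * x ^ (n + 2)) atTop (𝓝 0) := by
    have := ((tendsto_pow_atTop_nhds_zero_of_lt_one hx.le hx1).comp
      (tendsto_add_atTop_nat 2)).const_mul A
    simpa using this
  refine summable_of_ratio_test_tendsto_lt_one (l := 0) zero_lt_one
    (Eventually.of_forall fun n => (by positivity)) (hlim.congr fun n => ?_)
  rw [triangle_succ (n + 1), Real.norm_of_nonneg (by positivity),
    Real.norm_of_nonneg (by positivity)]
  have : A ^ n * x ^ ((n + 1) * (n + 2) / 2) ≠ 0 := by positivity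
  rw [eq_div_iff this]
  ring

lemma summable_kernel_bound {q : ℂ} (hq0 : q ≠ 0) (hq : ‖q‖ < 1) :
    Summable fun n : ℕ =>
      2 ^ n * ‖q‖ ^ ((n + 1) * (n + 2) / 2) * ((1 - ‖q‖)⁻¹) ^ (2 * n + 2) := by
  have h0 : 0 < (1 - ‖q‖)⁻¹ := inv_pos.mpr (by linarith)
  have := (summable_pow_mul_pow_triangle (norm_pos_iff.mpr hq0) hq
    (A := 2 * ((1 - ‖q‖)⁻¹) ^ 2) (by positivity)).mul_right (((1 - ‖q‖)⁻¹) ^ 2)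
  refine this.congr fun n => ?_
  rw [mul_pow, ← pow_mul]
  ring

lemma norm_signedWeight_mul_kernel_le {q : ℂ} (hq : ‖q‖ < 1) (n r : ℕ) :
    ‖signedWeight q n * (qPochhammerInv q ((n : ℤ) + 1 - r) * qPochhammerInv q ((n : ℤ) + 1 + r))‖ ≤
      2 ^ n * ‖q‖ ^ ((n + 1) * (n + 2) / 2) * ((1 - ‖q‖)⁻¹) ^ (2 * n + 2) := by
  rw [norm_mul]
  exact mul_le_mul (norm_signedWeight_le hq n) (norm_kernel_le hq n r) (norm_nonneg _)
    (by positivity)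

lemma kernel_telescope {q : ℂ} (hq0 : q ≠ 0) (hq : ‖q‖ < 1) (n r : ℕ) :
    (1 - q ^ (r + 1)) * (signedWeight q n * (qPochhammerInv q ((n : ℤ) + 1 - (r + 1 : ℕ)) *
        qPochhammerInv q ((n : ℤ) + 1 + (r + 1 : ℕ)))) =
      -(q ^ (r + 1) * (1 - q ^ r)) * (signedWeight q n *
        (qPochhammerInv q ((n : ℤ) + 1 - r) * qPochhammerInv q ((n : ℤ) + 1 + r))) -
      (1 - q ^ (2 * r + 1)) *
        (signedWeight q (n + 1) * (qPochhammerInv q (((n + 1 : ℕ) : ℤ) - r) *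
          qPochhammerInv q (((n + 1 : ℕ) : ℤ) + 1 + r)) -
        signedWeight q n * (qPochhammerInv q ((n : ℤ) - r) *
          qPochhammerInv q ((n : ℤ) + 1 + r))) := by
  have h1 := qPochhammerInv_sub_one hq ((n : ℤ) + 1 - r)
  have h2 := qPochhammerInv_sub_one hq ((n : ℤ) + 1 + 1 + r)
  rw [show (n : ℤ) + 1 - r - 1 = n - r by ring] at h1
  rw [show (n : ℤ) + 1 + 1 + r - 1 = n + 1 + r by ring] at h2
  rw [signedWeight_succ]
  push_cast
  rw [show (n : ℤ) + 1 - (r + 1) = n - r by ring,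
    show (n : ℤ) + 1 + (r + 1) = n + 1 + 1 + r by ring, h1, h2]
  generalize qPochhammerInv q ((n : ℤ) + 1 - r) = J
  generalize qPochhammerInv q ((n : ℤ) + 1 + 1 + r) = J'
  simp only [zpow_sub₀ hq0, zpow_add₀ hq0, zpow_natCast, zpow_one, pow_add, pow_mul', pow_one]
  have hr : q ^ r ≠ 0 := pow_ne_zero _ hq0
  field_simp
  ring

/-- The conjugate Bailey pair with `a = 1`, `ρ₁ = 1` and `ρ₂ → ∞`. -/
lemma hasSum_conjugate_bailey {q : ℂ} (hq0 : q ≠ 0) (hq : ‖q‖ < 1) (r : ℕ) :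
    HasSum (fun n : ℕ => (1 - q ^ (r + 1)) * (signedWeight q n *
        (qPochhammerInv q ((n : ℤ) + 1 - (r + 1 : ℕ)) *
        qPochhammerInv q ((n : ℤ) + 1 + (r + 1 : ℕ)))))
      ((-1) ^ (r + 1) * q ^ ((r + 1) * (r + 2) / 2)) := by
  have hsum (r : ℕ) : Summable fun n : ℕ => signedWeight q n *
      (qPochhammerInv q ((n : ℤ) + 1 - r) * qPochhammerInv q ((n : ℤ) + 1 + r)) :=
    (summable_kernel_bound hq0 hq).of_norm_bounded (norm_signedWeight_mul_kernel_le hq · r)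
  have hG (r : ℕ) : Tendsto (fun n : ℕ => signedWeight q n * (qPochhammerInv q ((n : ℤ) - r) *
      qPochhammerInv q ((n : ℤ) + 1 + r))) atTop (𝓝 0) := by
    have := (hsum r).norm.tendsto_atTop_zero.const_mul 2
    rw [mul_zero] at this
    refine squeeze_zero_norm' ?_ this
    filter_upwards [eventually_ge_atTop r] with n hn
    obtain ⟨m, rfl⟩ := Nat.exists_eq_add_of_le hn
    have h1 := qPochhammerInv_sub_one hq (((r + m : ℕ) : ℤ) + 1 - r)
    rw [show ((r + m : ℕ) : ℤ) + 1 - r - 1 = ((r + m : ℕ) : ℤ) - r by ring] at h1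
    rw [h1, show ((r + m : ℕ) : ℤ) + 1 - r = (m + 1 : ℕ) by push_cast; ring, zpow_natCast]
    simp only [norm_mul]
    have := norm_one_sub_pow_le hq (m + 1)
    calc _ = ‖1 - q ^ (m + 1)‖ * (‖signedWeight q (r + m)‖ * (‖qPochhammerInv q (m + 1 : ℕ)‖ *
          ‖qPochhammerInv q (((r + m : ℕ) : ℤ) + 1 + r)‖)) := by ring
      _ ≤ _ := by gcongr
  have htel (r : ℕ) : HasSum (fun n : ℕ =>
      signedWeight q (n + 1) * (qPochhammerInv q (((n + 1 : ℕ) : ℤ) - r) *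
          qPochhammerInv q (((n + 1 : ℕ) : ℤ) + 1 + r)) -
        signedWeight q n * (qPochhammerInv q ((n : ℤ) - r) *
          qPochhammerInv q ((n : ℤ) + 1 + r)))
      (-(signedWeight q 0 * (qPochhammerInv q (-r) * qPochhammerInv q (1 + r)))) := by
    have hs : Summable (fun n : ℕ =>
      signedWeight q (n + 1) * (qPochhammerInv q (((n + 1 : ℕ) : ℤ) - r) *
          qPochhammerInv q (((n + 1 : ℕ) : ℤ) + 1 + r)) -
        signedWeight q n * (qPochhammerInv q ((n : ℤ) - r) *
          qPochhammerInv q ((n : ℤ) + 1 + r))) := by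
      have hne := one_sub_pow_ne_zero hq (2 * r)
      refine ((((hsum r).mul_left (-(q ^ (r + 1) * (1 - q ^ r)))).sub
        ((hsum (r + 1)).mul_left (1 - q ^ (r + 1)))).mul_left
          (1 - q ^ (2 * r + 1))⁻¹).congr fun n => ?_
      rw [kernel_telescope hq0 hq, sub_sub_cancel, inv_mul_cancel_left₀ hne]
    rw [hs.hasSum_iff_tendsto_nat]
    simp_rw [sum_range_sub (fun n : ℕ => signedWeight q n * (qPochhammerInv q ((n : ℤ) - r) *
      qPochhammerInv q ((n : ℤ) + 1 + r)))]
    simpa using (hG r).sub_const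
      (signedWeight q 0 * (qPochhammerInv q (-r) * qPochhammerInv q (1 + r)))
  induction r with
  | zero =>
    have h := (htel 0).mul_left (-(1 - q))
    have hq1 : 1 - q ≠ 0 := by simpa using one_sub_pow_ne_zero hq 0
    have e0 : qPochhammerInv q 0 = 1 := by simpa using qPochhammerInv_natCast q 0
    have e1 : qPochhammerInv q 1 = (1 - q)⁻¹ := by simpa using qPochhammerInv_natCast q 1
    have hv : -(1 - q) * -(signedWeight q 0 *
        (qPochhammerInv q (-(0 : ℕ)) * qPochhammerInv q (1 + (0 : ℕ)))) =
        (-1) ^ (0 + 1) * q ^ ((0 + 1) * (0 + 2) / 2) := by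
      simp [e0, e1, signedWeight]
      field_simp
      ring
    rw [← hv]
    refine Eq.subst (motive := (HasSum · _)) (funext fun n => ?_) h
    rw [kernel_telescope hq0 hq n 0]
    ring
  | succ r ih =>
    have h := (ih.mul_left (-q ^ (r + 2))).sub
      ((htel (r + 1)).mul_left (1 - q ^ (2 * (r + 1) + 1)))
    rw [qPochhammerInv_of_neg q (k := -((r + 1 : ℕ) : ℤ)) (by omega)] at h
    rw [triangle_succ (r + 1), show (-1) ^ (r + 1 + 1) * q ^ ((r + 1) * (r + 1 + 1) / 2 +
      (r + 1 + 1)) = -q ^ (r + 2) * ((-1) ^ (r + 1) * q ^ ((r + 1) * (r + 2) / 2)) -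
        (1 - q ^ (2 * (r + 1) + 1)) * -(signedWeight q 0 *
          (0 * qPochhammerInv q (1 + (r + 1 : ℕ)))) by ring]
    refine Eq.subst (motive := (HasSum · _)) (funext fun n => ?_) h
    rw [kernel_telescope hq0 hq n (r + 1)]
    ring

lemma bailey_pair_partial_sum {q : ℂ} (hq0 : q ≠ 0) (hq : ‖q‖ < 1) (N : ℤ) (K : ℕ) :
    (1 - q ^ (N - 1)) * ∑ r ∈ range K, (1 - q ^ (r + 1)) *
        (-(q ^ (r * (r + 1) / 2) * thetaSum q (r + 1))) *
        ((1 + q ^ N) * (qPochhammerInv q (N - (r + 1)) * qPochhammerInv q (N + (r + 1))) -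
          qPochhammerInv q (N - 1 - (r + 1)) * qPochhammerInv q (N - 1 + (r + 1))) =
      q ^ (N - 1) * (-1) ^ (K + 1) * (q ^ (K * (K + 1) / 2) / q ^ K) * (1 - q ^ K) *
          (qPochhammerInv q (N - K - 1) * qPochhammerInv q (N + K - 1)) +
        (1 - q ^ (N - 1)) * q ^ N * q ^ (K * (K + 1) / 2) * q ^ K * thetaSum q K *
          (qPochhammerInv q (N - K - 1) * qPochhammerInv q (N + K)) := by
  induction K with
  | zero => simp [thetaSum]
  | succ K ih =>
    rw [sum_range_succ, mul_add, ih, thetaSum, triangle_succ]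
    have h1 := qPochhammerInv_sub_one hq (N - K - 1)
    have h2 := qPochhammerInv_sub_one hq (N + K)
    have h3 := qPochhammerInv_sub_one hq (N + K + 1)
    rw [add_sub_cancel_right] at h3
    push_cast
    rw [show N - 1 - ((K : ℤ) + 1) = N - K - 1 - 1 by ring,
      show N - ((K : ℤ) + 1) - 1 = N - K - 1 - 1 by ring,
      show N - ((K : ℤ) + 1) = N - K - 1 by ring,
      show N - 1 + ((K : ℤ) + 1) = N + K by ring,
      show N + ((K : ℤ) + 1) - 1 = N + K by ring,
      show N + ((K : ℤ) + 1) = N + K + 1 by ring, h1, h2, h3]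
    generalize qPochhammerInv q (N - K - 1) = J
    generalize qPochhammerInv q (N + K + 1) = J'
    generalize thetaSum q K = v
    simp only [zpow_sub₀ hq0, zpow_add₀ hq0, zpow_natCast, zpow_one, pow_add, pow_mul', pow_one]
    have hr : q ^ K ≠ 0 := pow_ne_zero _ hq0
    generalize q ^ K = x at *
    generalize q ^ (K * (K + 1) / 2) = t
    generalize q ^ N = y
    generalize (-1 : ℂ) ^ K = e
    field_simp
    ring

/-- The Bailey pair relative to `a = 1` with `β_n = 1 / (-q; q)_n` for `n ≥ 1`. -/
lemma bailey_pair {q : ℂ} (hq0 : q ≠ 0) (hq : ‖q‖ < 1) (n : ℕ) :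
    ∑ r ∈ range (n + 1), (1 - q ^ (r + 1)) * (-(q ^ (r * (r + 1) / 2) * thetaSum q (r + 1))) *
        (qPochhammerInv q ((n : ℤ) + 1 - (r + 1)) * qPochhammerInv q ((n : ℤ) + 1 + (r + 1))) =
      (∏ k ∈ range (n + 1), (1 + q ^ (k + 1)))⁻¹ := by
  induction n with
  | zero =>
    have hq1 : 1 - q ≠ 0 := by simpa using one_sub_pow_ne_zero hq 0
    have hq2 : 1 - q ^ 2 ≠ 0 := one_sub_pow_ne_zero hq 1
    have hq3 : 1 + q ≠ 0 := by simpa using one_add_pow_ne_zero hq 0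
    have e0 : qPochhammerInv q 0 = 1 := by simpa using qPochhammerInv_natCast q 0
    have e2 : qPochhammerInv q 2 = ((1 - q) * (1 - q ^ 2))⁻¹ := by
      simpa [prod_range_succ] using qPochhammerInv_natCast q 2
    simp [thetaSum, e0, e2]
    field_simp
    ring
  | succ n ih =>
    have hp := bailey_pair_partial_sum hq0 hq ((n : ℤ) + 2) (n + 2)
    rw [qPochhammerInv_of_neg q (k := (n : ℤ) + 2 - (n + 2 : ℕ) - 1) (by push_cast; omega)] at hp
    have hne : 1 - q ^ ((n : ℤ) + 2 - 1) ≠ 0 := by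
      rw [show (n : ℤ) + 2 - 1 = (n + 1 : ℕ) by push_cast; ring, zpow_natCast]
      exact one_sub_pow_ne_zero hq n
    simp only [zero_mul, mul_zero, add_zero] at hp
    replace hp := (mul_eq_zero.mp hp).resolve_left hne
    have hlast : ∑ r ∈ range (n + 2), (1 - q ^ (r + 1)) *
        (-(q ^ (r * (r + 1) / 2) * thetaSum q (r + 1))) *
        (qPochhammerInv q ((n : ℤ) + 2 - 1 - (r + 1)) *
          qPochhammerInv q ((n : ℤ) + 2 - 1 + (r + 1))) =
        (∏ k ∈ range (n + 1), (1 + q ^ (k + 1)))⁻¹ := by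
      rw [sum_range_succ, ← ih, qPochhammerInv_of_neg q (by push_cast; omega)]
      simp [show (n : ℤ) + 2 - 1 = n + 1 by ring]
    simp only [mul_sub, sum_sub_distrib, sub_eq_zero, hlast] at hp
    rw [prod_range_succ, mul_inv, eq_mul_inv_iff_mul_eq₀ (one_add_pow_ne_zero hq (n + 1)), ← hp,
      sum_mul]
    refine sum_congr rfl fun r _ => ?_
    rw [show ((n + 1 : ℕ) : ℤ) + 1 = n + 2 by push_cast; ring,
      show (n : ℤ) + 2 = (n + 2 : ℕ) by push_cast; ring, zpow_natCast]
    ring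

lemma thetaSum_eq_sum (q : ℂ) (r : ℕ) :
    thetaSum q r =
      ∑ j ∈ Finset.Ioc (-(r : ℤ)) (r : ℤ), (-1 : ℂ) ^ j * q ^ ((r : ℤ) ^ 2 - j ^ 2) := by
  induction r with
  | zero => simp [thetaSum]
  | succ r ih =>
    have hI : Finset.Ioc (-((r + 1 : ℕ) : ℤ)) ((r + 1 : ℕ) : ℤ) =
        insert ((r : ℤ) + 1) (insert (-(r : ℤ)) (Finset.Ioc (-(r : ℤ)) (r : ℤ))) := by
      ext j
      simp only [Finset.mem_Ioc, Finset.mem_insert]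
      omega
    rw [hI, sum_insert (by simp), sum_insert (by simp), thetaSum, ih, mul_sum]
    have hstep : ∀ j ∈ Finset.Ioc (-(r : ℤ)) (r : ℤ),
        q ^ (2 * r + 1) * ((-1 : ℂ) ^ j * q ^ ((r : ℤ) ^ 2 - j ^ 2)) =
          (-1 : ℂ) ^ j * q ^ (((r + 1 : ℕ) : ℤ) ^ 2 - j ^ 2) := by
      intro j hj
      rw [Finset.mem_Ioc] at hj
      have hpos : (r : ℤ) ^ 2 - j ^ 2 + (2 * r + 1 : ℕ) ≠ 0 := by
        push_cast
        nlinarith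
      rw [show ((r + 1 : ℕ) : ℤ) ^ 2 - j ^ 2 = (r : ℤ) ^ 2 - j ^ 2 + (2 * r + 1 : ℕ) by
        push_cast; ring, zpow_add' (Or.inr (Or.inl hpos)), zpow_natCast]
      ring
    rw [sum_congr rfl hstep,
      show ((r + 1 : ℕ) : ℤ) ^ 2 - ((r : ℤ) + 1) ^ 2 = 0 by push_cast; ring,
      show ((r + 1 : ℕ) : ℤ) ^ 2 - (-(r : ℤ)) ^ 2 = (2 * r + 1 : ℕ) by push_cast; ring,
      show (r : ℤ) + 1 = (r + 1 : ℕ) by push_cast; ring, zpow_neg, zpow_natCast, zpow_natCast,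
      zpow_natCast, ← inv_pow, inv_neg_one]
    simp
    ring

lemma sum_indefinite_eq_thetaSum (q : ℂ) (hq0 : q ≠ 0) (n : ℕ) :
    ∑ j ∈ Finset.Ioc (-(n + 1 : ℤ)) (n + 1 : ℤ),
        (-1 : ℂ) ^ ((n : ℤ) + 1 + j + 1) * q ^ (2 * (n + 1 : ℤ) ^ 2 - j ^ 2) =
      (-1) ^ (n + 1) * q ^ ((n + 1) * (n + 2) / 2) *
        -(q ^ (n * (n + 1) / 2) * thetaSum q (n + 1)) := by
  have hexp : (n + 1) ^ 2 = (n + 1) * (n + 2) / 2 + n * (n + 1) / 2 := by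
    have h : (n + 1) ^ 2 * 2 = n * (n + 1) + n * (n + 1) + 2 * (n + 1) := by ring
    have := triangle_succ n
    have := Nat.even_mul_succ_self n
    have := Nat.div_mul_cancel this.two_dvd
    omega
  have hpow : q ^ ((n + 1) ^ 2) = q ^ ((n + 1) * (n + 2) / 2) * q ^ (n * (n + 1) / 2) := by
    rw [← pow_add, ← hexp]
  rw [thetaSum_eq_sum, show (-1 : ℂ) ^ (n + 1) * q ^ ((n + 1) * (n + 2) / 2) *
    -(q ^ (n * (n + 1) / 2) * ∑ j ∈ Finset.Ioc (-((n + 1 : ℕ) : ℤ)) ((n + 1 : ℕ) : ℤ),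
      (-1 : ℂ) ^ j * q ^ (((n + 1 : ℕ) : ℤ) ^ 2 - j ^ 2)) =
    (-1 : ℂ) ^ (n + 2) * q ^ ((n + 1) ^ 2) *
      ∑ j ∈ Finset.Ioc (-((n + 1 : ℕ) : ℤ)) ((n + 1 : ℕ) : ℤ),
        (-1 : ℂ) ^ j * q ^ (((n + 1 : ℕ) : ℤ) ^ 2 - j ^ 2) by rw [hpow]; ring, mul_sum]
  push_cast
  refine sum_congr rfl fun j _ => ?_
  rw [show (n : ℤ) + 1 + j + 1 = (n + 2 : ℕ) + j by push_cast; ring,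
    show 2 * ((n : ℤ) + 1) ^ 2 - j ^ 2 = ((n + 1) ^ 2 : ℕ) + (((n : ℤ) + 1) ^ 2 - j ^ 2) by
      push_cast; ring, zpow_add₀ (by norm_num), zpow_add₀ hq0, zpow_natCast, zpow_natCast]
  ring

lemma norm_bailey_alpha_le {q : ℂ} (hq : ‖q‖ < 1) (r : ℕ) :
    ‖(1 - q ^ (r + 1)) * -(q ^ (r * (r + 1) / 2) * thetaSum q (r + 1))‖ ≤
      2 * (‖q‖ ^ (r * (r + 1) / 2) * (2 * 2 ^ (r + 1))) := by
  rw [norm_mul, norm_neg, norm_mul, norm_pow]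
  gcongr
  · exact norm_one_sub_pow_le hq _
  · refine (norm_thetaSum_le hq _).trans ?_
    gcongr
    exact_mod_cast Nat.lt_two_pow_self.le

lemma summable_bailey_alpha_bound {q : ℂ} (hq0 : q ≠ 0) (hq : ‖q‖ < 1) :
    Summable fun r : ℕ => 2 * (‖q‖ ^ (r * (r + 1) / 2) * (2 * 2 ^ (r + 1)) : ℝ) := by
  rw [← summable_nat_add_iff 1]
  refine ((summable_pow_mul_pow_triangle (norm_pos_iff.mpr hq0) hq two_pos).mul_left
    16).congr fun r => ?_
  ring

lemma summable_bailey_double {q : ℂ} (hq0 : q ≠ 0) (hq : ‖q‖ < 1) :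
    Summable (Function.uncurry fun n r : ℕ => signedWeight q n *
      (qPochhammerInv q ((n : ℤ) + 1 - (r + 1 : ℕ)) *
        qPochhammerInv q ((n : ℤ) + 1 + (r + 1 : ℕ))) *
      ((1 - q ^ (r + 1)) * -(q ^ (r * (r + 1) / 2) * thetaSum q (r + 1)))) := by
  have h0 : 0 < (1 - ‖q‖)⁻¹ := inv_pos.mpr (by linarith)
  refine ((summable_kernel_bound hq0 hq).mul_of_nonneg (summable_bailey_alpha_bound hq0 hq)
    (fun n => by positivity) (fun r => by positivity)).of_norm_bounded fun p => ?_
  rw [Function.uncurry, norm_mul]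
  exact mul_le_mul (norm_signedWeight_mul_kernel_le hq _ _) (norm_bailey_alpha_le hq _)
    (norm_nonneg _) (by positivity)

theorem lovejoy_bailey_pair (q : ℂ) (hq : ‖q‖ < 1) :
    ∑' n : ℕ, (∏ k ∈ range n, (1 - q ^ (k + 1))) * (-1 : ℂ) ^ (n + 1) *
        q ^ ((n + 1) * (n + 2) / 2) / ∏ k ∈ range (n + 1), (1 + q ^ (k + 1)) =
      ∑' n : ℕ, ∑ j ∈ Finset.Ioc (-(n + 1 : ℤ)) (n + 1 : ℤ),
        (-1 : ℂ) ^ ((n : ℤ) + 1 + j + 1) * q ^ (2 * (n + 1 : ℤ) ^ 2 - j ^ 2) := by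
  rcases eq_or_ne q 0 with rfl | hq0
  · have hl (n : ℕ) : (0 : ℂ) ^ ((n + 1) * (n + 2) / 2) = 0 :=
      zero_pow (by rw [triangle_succ]; omega)
    have hr (n : ℕ) : ∑ j ∈ Finset.Ioc (-(n + 1 : ℤ)) (n + 1 : ℤ),
        (-1 : ℂ) ^ ((n : ℤ) + 1 + j + 1) * 0 ^ (2 * (n + 1 : ℤ) ^ 2 - j ^ 2) = 0 := by
      refine sum_eq_zero fun j hj => ?_
      rw [Finset.mem_Ioc] at hj
      rw [zero_zpow _ (by nlinarith), mul_zero]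
    simp only [hl, hr, mul_zero, zero_div]
  · simp_rw [sum_indefinite_eq_thetaSum q hq0]
    calc _ = ∑' (n : ℕ) (r : ℕ), signedWeight q n *
          (qPochhammerInv q ((n : ℤ) + 1 - (r + 1 : ℕ)) *
            qPochhammerInv q ((n : ℤ) + 1 + (r + 1 : ℕ))) *
          ((1 - q ^ (r + 1)) * -(q ^ (r * (r + 1) / 2) * thetaSum q (r + 1))) := by
          refine tsum_congr fun n => ?_
          rw [tsum_eq_sum (s := range (n + 1)), div_eq_mul_inv, ← bailey_pair hq0 hq, mul_sum]
          · refine sum_congr rfl fun r _ => ?_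
            rw [signedWeight]
            push_cast
            ring
          · intro r hr
            rw [mem_range] at hr
            rw [qPochhammerInv_of_neg q (by push_cast; omega)]
            ring
      _ = _ := by
          rw [← (summable_bailey_double hq0 hq).tsum_comm]
          refine tsum_congr fun r => ?_
          rw [← ((hasSum_conjugate_bailey hq0 hq r).mul_right _).tsum_eq]
          refine tsum_congr fun n => ?_
          ring
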